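/- For every integer k ≥ 0, Σ_{n=1}^∞ H*_k(n+1)/(n(n+1)²) = k + 2 - (k+1) ζ(k+2). -/

import Mathlib

/-- The Riemann zeta value `ζ(k) = Σ_{n=1}^∞ n^{-k}`. -/
noncomputable def zeta (k : ℕ) : ℝ := ∑' n : ℕ, 1 / ((n : ℝ) + 1) ^ k

/-- The iterated harmonic sums: `H*_0(n) = 1` and `H*_k(n) = Σ_{m=1}^n H*_{k-1}(m)/m`. -/
noncomputable def iterHarmonic : ℕ → ℕ → ℝ
  | 0, _ => 1
  | k + 1, n => ∑ m ∈ Finset.Icc 1 n, iterHarmonic k m / m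

open Filter Topology PowerSeries

/-- The expansion of `1 / (N + 1 - X)` as a power series. -/
noncomputable def invLinear (N : ℕ) : ℝ⟦X⟧ := PowerSeries.mk fun k => 1 / ((N : ℝ) + 1) ^ (k + 1)

/-- The expansion of `m! / ((N + 1 - X) (N + 2 - X) ⋯ (N + m - X))` as a power series. -/
noncomputable def invPochhammer (N m : ℕ) : ℝ⟦X⟧ :=
  ∏ j ∈ Finset.range m, ((j : ℝ⟦X⟧) + 1) * invLinear (N + j)

lemma coeff_natCast_mul_powerSeries (k n : ℕ) (f : ℝ⟦X⟧) :
    coeff k ((n : ℝ⟦X⟧) * f) = n * coeff k f := by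
  rw [← map_natCast (C (R := ℝ)) n, coeff_C_mul]

lemma linear_mul_invLinear (N : ℕ) : ((N : ℝ⟦X⟧) + 1 - X) * invLinear N = 1 := by
  have hN : (N : ℝ) + 1 ≠ 0 := by positivity
  ext k
  rw [sub_mul, add_mul, one_mul, map_sub, map_add, coeff_natCast_mul_powerSeries]
  cases k with
  | zero => simp [invLinear]; field_simp
  | succ k =>
    rw [coeff_succ_X_mul]
    simp only [invLinear, coeff_mk, coeff_one]
    simp
    field_simp
    ring

lemma linear_ne_zero (N : ℕ) : (N : ℝ⟦X⟧) + 1 - X ≠ 0 :=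
  left_ne_zero_of_mul_eq_one (linear_mul_invLinear N)

lemma invPochhammer_succ (N m : ℕ) :
    ((N : ℝ⟦X⟧) + (m : ℝ⟦X⟧) + 1 - X) * invPochhammer N (m + 1) =
      ((m : ℝ⟦X⟧) + 1) * invPochhammer N m := by
  have h := linear_mul_invLinear (N + m)
  push_cast at h
  rw [invPochhammer, Finset.prod_range_succ, ← invPochhammer]
  linear_combination (((m : ℝ⟦X⟧) + 1) * invPochhammer N m) * h

lemma invPochhammer_shift (N m : ℕ) :
    ((N : ℝ⟦X⟧) + (m : ℝ⟦X⟧) + 1 - X) * invPochhammer (N + 1) m =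
      ((N : ℝ⟦X⟧) + 1 - X) * invPochhammer N m := by
  induction m with
  | zero => simp [invPochhammer]
  | succ m ih =>
    have h0 := linear_ne_zero (N + m)
    have h1 := invPochhammer_succ (N + 1) m
    have h2 := invPochhammer_succ N m
    push_cast at *
    apply mul_left_cancel₀ h0
    linear_combination ((N : ℝ⟦X⟧) + (m : ℝ⟦X⟧) + 1 - X) * h1 + ((m : ℝ⟦X⟧) + 1) * ih -
      ((N : ℝ⟦X⟧) + 1 - X) * h2

lemma invPochhammer_sub_shift (N p : ℕ) :
    invPochhammer N (p + 1) - invPochhammer (N + 1) (p + 1) =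
      ((p : ℝ⟦X⟧) + 1) ^ 2 *
        (invLinear N ^ 2 * (invPochhammer (N + 1) p - invPochhammer (N + 1) (p + 1))) := by
  have h0 := linear_ne_zero N
  have h1 := invPochhammer_succ (N + 1) p
  have h2 := invPochhammer_shift N (p + 1)
  have h3 := linear_mul_invLinear N
  have h4 : (((N : ℝ⟦X⟧) + 1 - X) * invLinear N) ^ 2 = 1 := by rw [h3, one_pow]
  push_cast at *
  apply mul_left_cancel₀ (pow_ne_zero 2 h0)
  linear_combination (-((N : ℝ⟦X⟧) + 1 - X)) * h2 + ((p : ℝ⟦X⟧) + 1) * h1 -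
    ((p : ℝ⟦X⟧) + 1) ^ 2 * (invPochhammer (N + 1) p - invPochhammer (N + 1) (p + 1)) * h4

lemma coeff_zero_invPochhammer_succ (N m : ℕ) :
    ((N : ℝ) + m + 1) * coeff 0 (invPochhammer N (m + 1)) =
      (m + 1) * coeff 0 (invPochhammer N m) := by
  simpa using congrArg (coeff 0) (invPochhammer_succ N m)

lemma coeff_succ_invPochhammer_succ (N m k : ℕ) :
    ((N : ℝ) + m + 1) * coeff (k + 1) (invPochhammer N (m + 1)) =
      (m + 1) * coeff (k + 1) (invPochhammer N m) + coeff k (invPochhammer N (m + 1)) := by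
  have h := congrArg (coeff (k + 1)) (invPochhammer_succ N m)
  simp only [sub_mul, add_mul, one_mul, map_sub, map_add, coeff_natCast_mul_powerSeries,
    coeff_succ_X_mul] at h
  linear_combination h

lemma coeff_invPochhammer_zero (N k : ℕ) :
    coeff k (invPochhammer N 0) = if k = 0 then 1 else 0 := by
  simp [invPochhammer, coeff_one]

lemma coeff_invPochhammer_nonneg (N k m : ℕ) : 0 ≤ coeff k (invPochhammer N m) := by
  induction k generalizing m with
  | zero =>
    induction m with
    | zero => simp [coeff_invPochhammer_zero]
    | succ m ih =>
      have h := coeff_zero_invPochhammer_succ N m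
      exact nonneg_of_mul_nonneg_right (h ▸ by positivity) (by positivity : 0 < (N : ℝ) + m + 1)
  | succ k ihk =>
    induction m with
    | zero => simp [coeff_invPochhammer_zero]
    | succ m ih =>
      have h := coeff_succ_invPochhammer_succ N m k
      have := ihk (m + 1)
      exact nonneg_of_mul_nonneg_right (h ▸ by positivity) (by positivity : 0 < (N : ℝ) + m + 1)

lemma coeff_invPochhammer_le (N k m : ℕ) :
    coeff k (invPochhammer (N + 1) (m + 1)) ≤ 1 / ((N : ℝ) + 1) := by
  have hN : (0 : ℝ) < N + 1 := by positivity
  have hN1 : 1 / ((N : ℝ) + 1) ≤ 1 := by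
    rw [div_le_one hN]; linarith [(Nat.cast_nonneg N : (0 : ℝ) ≤ N)]
  have hc : 1 / ((N : ℝ) + 1) * (N + 1) = 1 := by field_simp
  have hp : 0 < 1 / ((N : ℝ) + 1) := by positivity
  generalize 1 / ((N : ℝ) + 1) = c at *
  induction k generalizing m with
  | zero =>
    induction m with
    | zero =>
      have h := coeff_zero_invPochhammer_succ (N + 1) 0
      rw [coeff_invPochhammer_zero] at h
      push_cast at h
      refine le_of_mul_le_mul_left ?_ (by positivity : (0 : ℝ) < N + 1 + 0 + 1)
      simp at h
      simp
      nlinarith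
    | succ m ih =>
      have h := coeff_zero_invPochhammer_succ (N + 1) (m + 1)
      push_cast at h
      refine le_of_mul_le_mul_left ?_ (by positivity : (0 : ℝ) < N + 1 + (m + 1) + 1)
      have := mul_le_mul_of_nonneg_left ih (by positivity : (0 : ℝ) ≤ m + 1 + 1)
      nlinarith
  | succ k ihk =>
    have key (m : ℕ) : coeff (k + 1) (invPochhammer (N + 1) m) ≤ c := by
      induction m with
      | zero => simp [coeff_invPochhammer_zero, hp.le]
      | succ m ih =>
        have h := coeff_succ_invPochhammer_succ (N + 1) m k
        push_cast at h
        refine le_of_mul_le_mul_left ?_ (by positivity : (0 : ℝ) < N + 1 + m + 1)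
        have := mul_le_mul_of_nonneg_left ih (by positivity : (0 : ℝ) ≤ m + 1)
        nlinarith [ihk m]
    exact key (m + 1)

lemma coeff_mul_nonneg_powerSeries {f g : ℝ⟦X⟧} (hf : ∀ k, 0 ≤ coeff k f)
    (hg : ∀ k, 0 ≤ coeff k g) (k : ℕ) : 0 ≤ coeff k (f * g) := by
  rw [coeff_mul]
  exact Finset.sum_nonneg fun x _ => mul_nonneg (hf _) (hg _)

lemma coeff_invLinear_nonneg (N k : ℕ) : 0 ≤ coeff k (invLinear N) := by
  rw [invLinear, coeff_mk]; positivity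

lemma coeff_invLinear_sq (N k : ℕ) :
    coeff k (invLinear N ^ 2) = (k + 1) / ((N : ℝ) + 1) ^ (k + 2) := by
  have hN : (N : ℝ) + 1 ≠ 0 := by positivity
  rw [pow_two, coeff_mul, Finset.sum_congr rfl (g := fun _ => 1 / ((N : ℝ) + 1) ^ (k + 2))]
  · simp; ring
  · intro x hx
    rw [Finset.HasAntidiagonal.mem_antidiagonal] at hx
    rw [invLinear, coeff_mk, coeff_mk, ← hx]
    field_simp
    ring

lemma coeff_invPochhammer_antitone (k m : ℕ) :
    Antitone fun N => coeff k (invPochhammer N m) := by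
  refine antitone_nat_of_succ_le fun N => ?_
  have h0 := linear_ne_zero N
  have h2 := invPochhammer_shift N m
  have h3 := linear_mul_invLinear N
  have h : invPochhammer N m - invPochhammer (N + 1) m =
      (m : ℝ⟦X⟧) * (invLinear N * invPochhammer (N + 1) m) := by
    apply mul_left_cancel₀ h0
    linear_combination -h2 - m * invPochhammer (N + 1) m * h3
  have h' := congrArg (coeff k) h
  rw [map_sub, coeff_natCast_mul_powerSeries] at h'
  have := coeff_mul_nonneg_powerSeries (coeff_invLinear_nonneg N)
    (fun j => coeff_invPochhammer_nonneg (N + 1) j m) k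
  have : 0 ≤ (m : ℝ) * coeff k (invLinear N * invPochhammer (N + 1) m) := by positivity
  linarith

lemma iterHarmonic_succ_succ (k m : ℕ) :
    iterHarmonic (k + 1) (m + 1) =
      iterHarmonic (k + 1) m + iterHarmonic k (m + 1) / ((m : ℝ) + 1) := by
  simp only [iterHarmonic]
  rw [Finset.sum_Icc_succ_top (by omega)]
  push_cast
  rfl

lemma coeff_invPochhammer_zero_left (k m : ℕ) :
    coeff k (invPochhammer 0 m) = iterHarmonic k m := by
  induction k generalizing m with
  | zero =>
    induction m with
    | zero => simp [coeff_invPochhammer_zero, iterHarmonic]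
    | succ m ih =>
      have h := coeff_zero_invPochhammer_succ 0 m
      rw [ih] at h
      have hm : (m : ℝ) + 1 ≠ 0 := by positivity
      simp only [iterHarmonic] at *
      apply mul_left_cancel₀ hm
      linear_combination h
  | succ k ihk =>
    induction m with
    | zero => simp [coeff_invPochhammer_zero, iterHarmonic]
    | succ m ih =>
      have h := coeff_succ_invPochhammer_succ 0 m k
      rw [ih, ihk] at h
      have hm : (m : ℝ) + 1 ≠ 0 := by positivity
      rw [iterHarmonic_succ_succ]
      push_cast at h
      field_simp
      linear_combination h

lemma iterHarmonic_nonneg (k m : ℕ) : 0 ≤ iterHarmonic k m :=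
  coeff_invPochhammer_zero_left k m ▸ coeff_invPochhammer_nonneg 0 k m

lemma iterHarmonic_one (k : ℕ) : iterHarmonic k 1 = 1 := by
  induction k with
  | zero => rfl
  | succ k ih => simp [iterHarmonic, ih]

lemma tendsto_iterHarmonic_div (k : ℕ) :
    Tendsto (fun m : ℕ => iterHarmonic k (m + 1) / ((m : ℝ) + 1)) atTop (𝓝 0) := by
  induction k with
  | zero => exact tendsto_one_div_add_atTop_nhds_zero_nat
  | succ k ih =>
    have h := (tendsto_add_atTop_iff_nat 1).2 ih.cesaro
    refine h.congr fun m => ?_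
    have hs (n : ℕ) : ∑ i ∈ Finset.range n, iterHarmonic k (i + 1) / ((i : ℝ) + 1) =
        iterHarmonic (k + 1) n := by
      induction n with
      | zero => simp [iterHarmonic]
      | succ n ihn => rw [Finset.sum_range_succ, ihn, iterHarmonic_succ_succ]
    rw [hs]
    push_cast
    ring

lemma tendsto_coeff_invPochhammer_one (k : ℕ) :
    Tendsto (fun m : ℕ => coeff k (invPochhammer 1 m)) atTop (𝓝 0) := by
  refine squeeze_zero (fun m => coeff_invPochhammer_nonneg 1 k m) (fun m => ?_)
    (tendsto_iterHarmonic_div k)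
  have h1 := invPochhammer_shift 0 m
  have h2 := invPochhammer_succ 0 m
  have hm := linear_ne_zero m
  have h : ((m + 1 : ℕ) : ℝ⟦X⟧) * invPochhammer 1 m = (1 - X) * invPochhammer 0 (m + 1) := by
    push_cast at *
    apply mul_left_cancel₀ hm
    linear_combination ((m : ℝ⟦X⟧) + 1) * h1 - (1 - X) * h2
  have h' := congrArg (coeff k) h
  rw [coeff_natCast_mul_powerSeries, sub_mul, one_mul, map_sub,
    coeff_invPochhammer_zero_left] at h'
  have hx : 0 ≤ coeff k (X * invPochhammer 0 (m + 1)) := by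
    cases k with
    | zero => simp
    | succ k => rw [coeff_succ_X_mul]; exact coeff_invPochhammer_nonneg _ _ _
  rw [le_div_iff₀ (by positivity)]
  push_cast at h'
  linarith

lemma sum_iterHarmonic_div_sq (k M K : ℕ) :
    ∑ p ∈ Finset.range M, iterHarmonic k (p + 1) / ((p : ℝ) + 1) ^ 2 =
      ∑ N ∈ Finset.range K, (k + 1) / ((N : ℝ) + 1) ^ (k + 2) -
      ∑ N ∈ Finset.range K, coeff k (invLinear N ^ 2 * invPochhammer (N + 1) M) +
      ∑ p ∈ Finset.range M, coeff k (invPochhammer K (p + 1)) / ((p : ℝ) + 1) ^ 2 := by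
  induction K with
  | zero => simp [coeff_invPochhammer_zero_left]
  | succ K ih =>
    have hstep (p : ℕ) : coeff k (invPochhammer K (p + 1)) / ((p : ℝ) + 1) ^ 2 =
        coeff k (invPochhammer (K + 1) (p + 1)) / ((p : ℝ) + 1) ^ 2 +
        (coeff k (invLinear K ^ 2 * invPochhammer (K + 1) p) -
          coeff k (invLinear K ^ 2 * invPochhammer (K + 1) (p + 1))) := by
      have h := congrArg (coeff k) (invPochhammer_sub_shift K p)
      rw [show ((p : ℝ⟦X⟧) + 1) ^ 2 = (((p + 1) ^ 2 : ℕ) : ℝ⟦X⟧) by push_cast; ring,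
        coeff_natCast_mul_powerSeries, mul_sub, map_sub, map_sub] at h
      push_cast at h
      field_simp
      linear_combination h
    rw [ih, Finset.sum_congr rfl fun p _ => hstep p, Finset.sum_add_distrib,
      Finset.sum_range_sub', Finset.sum_range_succ, Finset.sum_range_succ,
      ← coeff_invLinear_sq]
    simp only [invPochhammer, Finset.range_zero, Finset.prod_empty, mul_one]
    ring

lemma summable_one_div_succ_pow (k : ℕ) :
    Summable fun n : ℕ => 1 / ((n : ℝ) + 1) ^ (k + 2) := by
  have h := (summable_nat_add_iff 1).2
    (Real.summable_one_div_nat_pow.2 (by omega : 1 < k + 2))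
  simpa using h

lemma tendsto_sum_zeta (k : ℕ) :
    Tendsto (fun M => ∑ n ∈ Finset.range M, 1 / ((n : ℝ) + 1) ^ (k + 2)) atTop
      (𝓝 (zeta (k + 2))) :=
  (summable_one_div_succ_pow k).hasSum.tendsto_sum_nat

lemma coeff_invLinear_sq_mul_le (N M k : ℕ) :
    coeff k (invLinear N ^ 2 * invPochhammer (N + 1) M) ≤
      (∑ x ∈ Finset.HasAntidiagonal.antidiagonal k, ((x.1 : ℝ) + 1) * coeff x.2 (invPochhammer 1 M)) *
        (1 / ((N : ℝ) + 1) ^ (0 + 2)) := by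
  rw [coeff_mul, Finset.sum_mul]
  refine Finset.sum_le_sum fun x _ => ?_
  have h1 : coeff x.2 (invPochhammer (N + 1) M) ≤ coeff x.2 (invPochhammer 1 M) :=
    coeff_invPochhammer_antitone x.2 M (by omega)
  have h0 := coeff_invPochhammer_nonneg (N + 1) x.2 M
  have hN : (1 : ℝ) ≤ N + 1 := by linarith [(Nat.cast_nonneg N : (0 : ℝ) ≤ N)]
  have h2 : ((x.1 : ℝ) + 1) / ((N : ℝ) + 1) ^ (x.1 + 2) ≤
      ((x.1 : ℝ) + 1) / ((N : ℝ) + 1) ^ (0 + 2) := by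
    gcongr
    exact Nat.zero_le _
  rw [coeff_invLinear_sq]
  calc _ ≤ ((x.1 : ℝ) + 1) / ((N : ℝ) + 1) ^ (0 + 2) * coeff x.2 (invPochhammer 1 M) :=
        mul_le_mul h2 h1 h0 (by positivity)
    _ = _ := by ring

lemma tendsto_sum_iterHarmonic_div_sq (k : ℕ) :
    Tendsto (fun M => ∑ p ∈ Finset.range M, iterHarmonic k (p + 1) / ((p : ℝ) + 1) ^ 2) atTop
      (𝓝 ((k + 1) * zeta (k + 2))) := by
  rw [← tendsto_add_atTop_iff_nat 1]
  have main : Tendsto (fun M : ℕ => ∑ N ∈ Finset.range (M + 1),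
      (k + 1) / ((N : ℝ) + 1) ^ (k + 2)) atTop (𝓝 ((k + 1) * zeta (k + 2))) := by
    refine (((tendsto_add_atTop_iff_nat 1).2 (tendsto_sum_zeta k)).const_mul
      ((k : ℝ) + 1)).congr fun M => ?_
    rw [Finset.mul_sum]
    exact Finset.sum_congr rfl fun N _ => by ring
  have hz := (tendsto_add_atTop_iff_nat 1).2 (tendsto_sum_zeta 0)
  have err₁ : Tendsto (fun M : ℕ => ∑ N ∈ Finset.range (M + 1),
      coeff k (invLinear N ^ 2 * invPochhammer (N + 1) (M + 1))) atTop (𝓝 0) := by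
    have hε : Tendsto (fun M : ℕ => ∑ x ∈ Finset.HasAntidiagonal.antidiagonal k,
        ((x.1 : ℝ) + 1) * coeff x.2 (invPochhammer 1 (M + 1))) atTop (𝓝 0) := by
      have := tendsto_finsetSum (Finset.HasAntidiagonal.antidiagonal k) fun x _ =>
        ((tendsto_add_atTop_iff_nat 1).2 (tendsto_coeff_invPochhammer_one x.2)).const_mul
          ((x.1 : ℝ) + 1)
      simpa using this
    have hb := hε.mul hz
    rw [zero_mul] at hb
    refine squeeze_zero (fun M => Finset.sum_nonneg fun N _ => ?_) (fun M => ?_) hb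
    · refine coeff_mul_nonneg_powerSeries (fun j => ?_)
        (fun j => coeff_invPochhammer_nonneg _ j _) k
      rw [coeff_invLinear_sq]
      positivity
    · rw [Finset.mul_sum]
      exact Finset.sum_le_sum fun N _ => coeff_invLinear_sq_mul_le N (M + 1) k
  have err₂ : Tendsto (fun M : ℕ => ∑ p ∈ Finset.range (M + 1),
      coeff k (invPochhammer (M + 1) (p + 1)) / ((p : ℝ) + 1) ^ 2) atTop (𝓝 0) := by
    have hb := (tendsto_one_div_add_atTop_nhds_zero_nat (𝕜 := ℝ)).mul hz
    rw [zero_mul] at hb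
    refine squeeze_zero (fun M => Finset.sum_nonneg fun p _ =>
      div_nonneg (coeff_invPochhammer_nonneg _ _ _) (by positivity)) (fun M => ?_) hb
    rw [Finset.mul_sum]
    refine Finset.sum_le_sum fun p _ => ?_
    rw [div_eq_mul_one_div]
    exact mul_le_mul_of_nonneg_right (coeff_invPochhammer_le M k p) (by positivity)
  have h := (main.sub err₁).add err₂
  rw [sub_zero, add_zero] at h
  exact h.congr fun M => (sum_iterHarmonic_div_sq k (M + 1) (M + 1)).symm

lemma sum_iterHarmonic_succ_div (k M : ℕ) :
    ∑ n ∈ Finset.range M, iterHarmonic (k + 1) (n + 2) / (((n : ℝ) + 1) * (n + 2)) =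
      ∑ n ∈ Finset.range M, iterHarmonic k (n + 2) / (((n : ℝ) + 1) * (n + 2)) +
        (1 - iterHarmonic (k + 1) (M + 1) / ((M : ℝ) + 1)) := by
  induction M with
  | zero => simp [iterHarmonic_one]
  | succ M ih =>
    have h := iterHarmonic_succ_succ k (M + 1)
    rw [Finset.sum_range_succ, Finset.sum_range_succ, ih, h]
    have : (M : ℝ) + 1 + 1 = M + 2 := by ring
    push_cast
    rw [this]
    field_simp
    ring

lemma tendsto_sum_iterHarmonic_div (k : ℕ) :
    Tendsto (fun M => ∑ n ∈ Finset.range M,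
      iterHarmonic k (n + 2) / (((n : ℝ) + 1) * (n + 2))) atTop (𝓝 (k + 1)) := by
  induction k with
  | zero =>
    have h := (tendsto_one_div_add_atTop_nhds_zero_nat (𝕜 := ℝ)).const_sub 1
    rw [sub_zero] at h
    rw [Nat.cast_zero, zero_add]
    refine h.congr fun M => ?_
    induction M with
    | zero => simp
    | succ M ih =>
      rw [Finset.sum_range_succ, ← ih]
      simp only [iterHarmonic]
      push_cast
      field_simp
      ring
  | succ k ih =>
    have h := ih.add ((tendsto_iterHarmonic_div (k + 1)).const_sub 1)
    rw [sub_zero] at h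
    push_cast
    exact h.congr fun M => (sum_iterHarmonic_succ_div k M).symm

theorem stmt17 (k : ℕ) :
    ∑' n : ℕ, iterHarmonic k (n + 2) / (((n : ℝ) + 1) * ((n : ℝ) + 2) ^ 2) =
      k + 2 - (k + 1) * zeta (k + 2) := by
  refine HasSum.tsum_eq ((hasSum_iff_tendsto_nat_of_nonneg (fun n =>
    div_nonneg (iterHarmonic_nonneg _ _) (by positivity)) _).2 ?_)
  have h := (tendsto_sum_iterHarmonic_div k).sub
    (((tendsto_add_atTop_iff_nat 1).2 (tendsto_sum_iterHarmonic_div_sq k)).sub_const 1)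
  rw [show (k : ℝ) + 2 - (k + 1) * zeta (k + 2) = k + 1 - ((k + 1) * zeta (k + 2) - 1) by ring]
  refine h.congr fun M => ?_
  rw [Finset.sum_range_succ']
  simp only [zero_add, iterHarmonic_one, Nat.cast_zero, one_pow, div_one, add_sub_cancel_right]
  rw [← Finset.sum_sub_distrib]
  refine Finset.sum_congr rfl fun n _ => ?_
  have : (n : ℝ) + 1 + 1 = n + 2 := by ring
  push_cast
  rw [this]
  field_simp
  ring
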